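/- arXiv:1205.2910 — 10 statements merged into one kernel-verified Lean document; each statement's English description precedes it below -/
import Mathlib

section
/- Let (P, ·, {,}) be a Poisson superalgebra over K. Define a bilinear product on P by xy := x·y + {x,y}. Then for all homogeneous x, y, z ∈ P this product satisfies the identity 3(xy)z − 3x(yz) + (−1)^{|x||y|}(yx)z − (−1)^{|y||z|}(xz)y − (−1)^{|x||y|+|x||z|}(yz)x + (−1)^{|x||z|+|y||z|}(zx)y = 0. -/
/-- The sign `(-1)^i` for `i : ZMod 2`, valued in the field `K`. -/
def sgn (K : Type*) [Field K] (i : ZMod 2) : K := (-1 : K) ^ i.val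

/-- The left-hand side of the super-Poisson identity
`3(xy)z − 3x(yz) + (−1)^{|x||y|}(yx)z − (−1)^{|y||z|}(xz)y − (−1)^{|x||y|+|x||z|}(yz)x
  + (−1)^{|x||z|+|y||z|}(zx)y` for homogeneous `x, y, z` of degrees `i, j, k`. -/
def spId (K : Type*) {V : Type*} [Field K] [AddCommGroup V] [Module K V]
    (mul : V → V → V) (i j k : ZMod 2) (x y z : V) : V :=
  (3 : K) • mul (mul x y) z - (3 : K) • mul x (mul y z)
    + sgn K (i * j) • mul (mul y x) z - sgn K (j * k) • mul (mul x z) y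
    - sgn K (i * j + i * k) • mul (mul y z) x + sgn K (i * k + j * k) • mul (mul z x) y

/-- A product on a `ZMod 2`-graded space is a super-Poisson product if the
super-Poisson identity holds for all homogeneous elements. -/
def IsSuperPoisson (K : Type*) {V : Type*} [Field K] [AddCommGroup V] [Module K V]
    (P : ZMod 2 → Submodule K V) (mul : V → V → V) : Prop :=
  ∀ i j k : ZMod 2, ∀ x ∈ P i, ∀ y ∈ P j, ∀ z ∈ P k, spId K mul i j k x y z = 0

/-- The associator `A(x,y,z) = (xy)z − x(yz)`. -/
def assocr {V : Type*} [AddCommGroup V] (mul : V → V → V) (x y z : V) : V :=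
  mul (mul x y) z - mul x (mul y z)

/-- The supersymmetrized product `x∘y = (1/2)(xy + (−1)^{|x||y|} yx)` on homogeneous
elements of degrees `i, j`. -/
def scirc (K : Type*) {V : Type*} [Field K] [AddCommGroup V] [Module K V]
    (mul : V → V → V) (i j : ZMod 2) (x y : V) : V :=
  (2 : K)⁻¹ • (mul x y + sgn K (i * j) • mul y x)

/-- The super bracket `{x,y} = (1/2)(xy − (−1)^{|x||y|} yx)` on homogeneous
elements of degrees `i, j`. -/
def sbr (K : Type*) {V : Type*} [Field K] [AddCommGroup V] [Module K V]
    (mul : V → V → V) (i j : ZMod 2) (x y : V) : V :=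
  (2 : K)⁻¹ • (mul x y - sgn K (i * j) • mul y x)

theorem sgn_add (K : Type*) [Field K] (i j : ZMod 2) : sgn K (i + j) = sgn K i * sgn K j := by
  have key : ∀ i j : ZMod 2, (-1 : ℤ) ^ (i + j).val = (-1) ^ i.val * (-1) ^ j.val := by decide
  simpa [sgn] using congrArg (Int.cast : ℤ → K) (key i j)

theorem sgn_eq_one_or_neg_one (K : Type*) [Field K] (i : ZMod 2) :
    sgn K i = 1 ∨ sgn K i = -1 :=
  neg_one_pow_eq_or K _

/-- If `(P, ·, {,})` is a Poisson superalgebra, the product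
`xy := x·y + {x,y}` satisfies the super-Poisson identity on homogeneous elements. -/
theorem poisson_superalgebra_gives_superPoisson_product
    (K V : Type*) [Field K] [CharZero K] [AddCommGroup V] [Module K V]
    (P : ZMod 2 → Submodule K V) (hP : DirectSum.IsInternal P)
    (cdot lie : V →ₗ[K] V →ₗ[K] V)
    (hcdotGraded : ∀ i j : ZMod 2, ∀ x ∈ P i, ∀ y ∈ P j, cdot x y ∈ P (i + j))
    (hlieGraded : ∀ i j : ZMod 2, ∀ x ∈ P i, ∀ y ∈ P j, lie x y ∈ P (i + j))
    (hassoc : ∀ x y z : V, cdot (cdot x y) z = cdot x (cdot y z))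
    (hscomm : ∀ i j : ZMod 2, ∀ x ∈ P i, ∀ y ∈ P j, cdot x y = sgn K (i * j) • cdot y x)
    (hanti : ∀ i j : ZMod 2, ∀ x ∈ P i, ∀ y ∈ P j, lie x y = -(sgn K (i * j)) • lie y x)
    (hjacobi : ∀ i j k : ZMod 2, ∀ x ∈ P i, ∀ y ∈ P j, ∀ z ∈ P k,
      sgn K (k * i) • lie x (lie y z) + sgn K (i * j) • lie y (lie z x)
        + sgn K (j * k) • lie z (lie x y) = 0)
    (hleibniz : ∀ i j k : ZMod 2, ∀ x ∈ P i, ∀ y ∈ P j, ∀ z ∈ P k,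
      lie x (cdot y z) = cdot (lie x y) z + sgn K (i * j) • cdot y (lie x z)) :
    ∀ i j k : ZMod 2, ∀ x ∈ P i, ∀ y ∈ P j, ∀ z ∈ P k,
      spId K (fun u v => cdot u v + lie u v) i j k x y z = 0 := by
  intro i j k x hx y hy z hz
  have cyx := hscomm j i y hy x hx
  have czx := hscomm k i z hz x hx
  have czy := hscomm k j z hz y hy
  have lyx := hanti j i y hy x hx
  have lzx := hanti k i z hz x hx
  have lzy := hanti k j z hz y hy
  have cc_yz_x := hscomm _ i _ (hcdotGraded j k y hy z hz) x hx
  have cl_yz_x := hscomm _ i _ (hlieGraded j k y hy z hz) x hx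
  have cl_xz_y := hscomm _ j _ (hlieGraded i k x hx z hz) y hy
  have lc_xy_z := hanti _ k _ (hcdotGraded i j x hx y hy) z hz
  have lc_xz_y := hanti _ j _ (hcdotGraded i k x hx z hz) y hy
  have lc_yz_x := hanti _ i _ (hcdotGraded j k y hy z hz) x hx
  have ll_xy_z := hanti _ k _ (hlieGraded i j x hx y hy) z hz
  have ll_xz_y := hanti _ j _ (hlieGraded i k x hx z hz) y hy
  have ll_yz_x := hanti _ i _ (hlieGraded j k y hy z hz) x hx
  have dx := hleibniz i j k x hx y hy z hz
  have dy := hleibniz j i k y hy x hx z hz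
  have dz := hleibniz k i j z hz x hx y hy
  have J := hjacobi i j k x hx y hy z hz
  have a_xz_y := hassoc x z y
  have a_xy_z := hassoc x y z
  simp only [spId, sgn_add, add_mul, mul_comm j i, mul_comm k i, mul_comm k j] at *
  rcases sgn_eq_one_or_neg_one K (i * j) with ha | ha <;>
  rcases sgn_eq_one_or_neg_one K (j * k) with hb | hb <;>
  rcases sgn_eq_one_or_neg_one K (i * k) with hc | hc <;>
  · simp only [ha, hb, hc, mul_one, mul_neg, neg_neg, one_smul, neg_smul] at *
    simp only [map_add, map_neg, LinearMap.add_apply, LinearMap.neg_apply, neg_neg,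
      cyx, czx, czy, lyx, lzx, lzy, a_xy_z, a_xz_y, cc_yz_x, cl_yz_x, cl_xz_y,
      lc_xy_z, lc_xz_y, lc_yz_x, ll_xy_z, ll_xz_y, ll_yz_x, dx, dy, dz] at J ⊢
    first
    | linear_combination (norm := module) (-2 : K) • J
    | linear_combination (norm := module) (2 : K) • J
end

section
/- Let P carry a super-Poisson product xy. Define x∘y := (1/2)(xy + (−1)^{|x||y|} yx) for homogeneous x, y. Then ∘ is associative on homogeneous elements: (x∘y)∘z = x∘(y∘z) for all homogeneous x, y, z ∈ P. -/
/-- For a super-Poisson product, `x∘y := (1/2)(xy + (−1)^{|x||y|} yx)`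
is associative on homogeneous elements. -/
theorem superPoisson_scirc_assoc
    (K V : Type*) [Field K] [CharZero K] [AddCommGroup V] [Module K V]
    (P : ZMod 2 → Submodule K V) (hP : DirectSum.IsInternal P)
    (mul : V →ₗ[K] V →ₗ[K] V)
    (hgr : ∀ i j : ZMod 2, ∀ x ∈ P i, ∀ y ∈ P j, mul x y ∈ P (i + j))
    (hSP : IsSuperPoisson K P (fun u v => mul u v)) :
    ∀ i j k : ZMod 2, ∀ x ∈ P i, ∀ y ∈ P j, ∀ z ∈ P k,
      scirc K (fun u v => mul u v) (i + j) k (scirc K (fun u v => mul u v) i j x y) z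
        = scirc K (fun u v => mul u v) i (j + k) x (scirc K (fun u v => mul u v) j k y z) := by
  intro i j k x hx y hy z hz
  have hxyz := hSP i j k x hx y hy z hz
  have hxzy := hSP i k j x hx z hz y hy
  have hzxy := hSP k i j z hz x hx y hy
  have hzyx := hSP k j i z hz y hy x hx
  simp only [spId, mul_comm k i, mul_comm k j, mul_comm j i, sgn_add] at hxyz hxzy hzxy hzyx
  simp only [scirc, add_mul, mul_add, sgn_add, map_add, map_smul, LinearMap.add_apply,
    LinearMap.smul_apply]
  -- The coefficients are forced by the monomials of the form `a(bc)`.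
  rcases sgn_eq_one_or_neg_one K (i * j) with hij | hij <;>
  rcases sgn_eq_one_or_neg_one K (i * k) with hik | hik <;>
  rcases sgn_eq_one_or_neg_one K (j * k) with hjk | hjk <;>
  linear_combination (norm := (simp only [hij, hik, hjk]; module))
    (12 : K)⁻¹ • (hxyz + sgn K (j * k) • hxzy - (sgn K (i * k) * sgn K (j * k)) • hzxy
      - (sgn K (i * j) * sgn K (i * k) * sgn K (j * k)) • hzyx)
end

section
/- Let P carry a super-Poisson product xy. Define x∘y := (1/2)(xy + (−1)^{|x||y|} yx) and {x,y} := (1/2)(xy − (−1)^{|x||y|} yx) for homogeneous x, y. Then the super Leibniz rule holds: {x, y∘z} = {x,y}∘z + (−1)^{|x||y|} y∘{x,z} for all homogeneous x, y, z ∈ P. -/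
/-- For a super-Poisson product, the induced bracket and symmetric product
satisfy the super Leibniz rule `{x, y∘z} = {x,y}∘z + (−1)^{|x||y|} y∘{x,z}`. -/
theorem superPoisson_leibniz
    (K V : Type*) [Field K] [CharZero K] [AddCommGroup V] [Module K V]
    (P : ZMod 2 → Submodule K V) (hP : DirectSum.IsInternal P)
    (mul : V →ₗ[K] V →ₗ[K] V)
    (hgr : ∀ i j : ZMod 2, ∀ x ∈ P i, ∀ y ∈ P j, mul x y ∈ P (i + j))
    (hSP : IsSuperPoisson K P (fun u v => mul u v)) :
    ∀ i j k : ZMod 2, ∀ x ∈ P i, ∀ y ∈ P j, ∀ z ∈ P k,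
      sbr K (fun u v => mul u v) i (j + k) x (scirc K (fun u v => mul u v) j k y z)
        = scirc K (fun u v => mul u v) (i + j) k (sbr K (fun u v => mul u v) i j x y) z
          + sgn K (i * j) •
            scirc K (fun u v => mul u v) j (i + k) y (sbr K (fun u v => mul u v) i k x z) := by
  intro i j k x hx y hy z hz
  have hxyz := hSP i j k x hx y hy z hz
  have hxzy := hSP i k j x hx z hz y hy
  have hyxz := hSP j i k y hy x hx z hz
  have hyzx := hSP j k i y hy z hz x hx
  have hzxy := hSP k i j z hz x hx y hy
  have hzyx := hSP k j i z hz y hy x hx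
  simp only [spId, sbr, scirc, mul_add, add_mul, sgn_add, mul_comm j i, mul_comm k i,
    mul_comm k j, map_add, map_sub, map_smul, LinearMap.add_apply, LinearMap.sub_apply,
    LinearMap.smul_apply] at *
  generalize ha : sgn K (i * j) = a at *
  generalize hb : sgn K (i * k) = b at *
  generalize hc : sgn K (j * k) = c at *
  have ha' : a = 1 ∨ a = -1 := ha ▸ sgn_eq_one_or_neg_one K _
  have hb' : b = 1 ∨ b = -1 := hb ▸ sgn_eq_one_or_neg_one K _
  have hc' : c = 1 ∨ c = -1 := hc ▸ sgn_eq_one_or_neg_one K _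
  clear ha hb hc
  linear_combination (norm := skip) (-1 / 12 : K) • hxyz - (c / 12) • hxzy
    + (b * c / 12) • hzxy - (a * b * c / 12) • hzyx + (a / 12) • hyxz - (a * b / 12) • hyzx
  rcases ha' with rfl | rfl <;> rcases hb' with rfl | rfl <;> rcases hc' with rfl | rfl <;> module
end

section
/- Let P carry a super-Poisson product xy. Then the product is super flexible: for all homogeneous x, y, z ∈ P, A(x,y,z) + (−1)^{|x||z|+|x||y|+|y||z|} A(z,y,x) = 0, where A(x,y,z) = (xy)z − x(yz) is the associator. -/
/-- A super-Poisson product is super flexible: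
`A(x,y,z) + (−1)^{|x||z|+|x||y|+|y||z|} A(z,y,x) = 0` on homogeneous elements. -/
theorem superPoisson_superFlexible
    (K V : Type*) [Field K] [CharZero K] [AddCommGroup V] [Module K V]
    (P : ZMod 2 → Submodule K V) (hP : DirectSum.IsInternal P)
    (mul : V →ₗ[K] V →ₗ[K] V)
    (hgr : ∀ i j : ZMod 2, ∀ x ∈ P i, ∀ y ∈ P j, mul x y ∈ P (i + j))
    (hSP : IsSuperPoisson K P (fun u v => mul u v)) :
    ∀ i j k : ZMod 2, ∀ x ∈ P i, ∀ y ∈ P j, ∀ z ∈ P k,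
      assocr (fun u v => mul u v) x y z
        + sgn K (i * k + i * j + j * k) • assocr (fun u v => mul u v) z y x = 0 := by
  intro i j k x hx y hy z hz
  have h₁ := hSP i j k x hx y hy z hz
  have h₂ := hSP k j i z hz y hy x hx
  rw [spId, mul_comm k j, mul_comm k i, mul_comm j i] at h₂
  rw [spId] at h₁
  simp only [assocr, sgn_add] at h₁ h₂ ⊢
  refine (smul_eq_zero_iff_right (three_ne_zero : (3 : K) ≠ 0)).mp ?_
  rcases sgn_eq_one_or_neg_one K (i * j) with ha | ha <;>
  rcases sgn_eq_one_or_neg_one K (j * k) with hb | hb <;>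
  rcases sgn_eq_one_or_neg_one K (i * k) with hc | hc <;>
  · rw [ha, hb, hc] at h₁ h₂ ⊢
    first
    | linear_combination (norm := module) h₁ + h₂
    | linear_combination (norm := module) h₁ - h₂
end

section
/- Let P carry a super-Poisson product xy. Then for every odd homogeneous element y ∈ P₁, one has (yy)(yy) = y(y(yy)), i.e. y²y² = yy³ where y² = yy and y³ = y(yy). -/
/-- For a super-Poisson product and an odd homogeneous element `y`,
one has `(yy)(yy) = y(y(yy))`, i.e. `y²y² = yy³`. -/
theorem superPoisson_odd_fourth_power
    (K V : Type*) [Field K] [CharZero K] [AddCommGroup V] [Module K V]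
    (P : ZMod 2 → Submodule K V) (hP : DirectSum.IsInternal P)
    (mul : V →ₗ[K] V →ₗ[K] V)
    (hgr : ∀ i j : ZMod 2, ∀ x ∈ P i, ∀ y ∈ P j, mul x y ∈ P (i + j))
    (hSP : IsSuperPoisson K P (fun u v => mul u v))
    (y : V) (hy : y ∈ P 1) :
    mul (mul y y) (mul y y) = mul y (mul y (mul y y)) := by
  have h1 : (1 : ZMod 2) + 1 = 0 := by decide
  have s0 : sgn K 0 = 1 := by simp [sgn]
  have s1 : sgn K 1 = -1 := by simp [sgn, ZMod.val_one]
  have hs : mul y y ∈ P 0 := h1 ▸ hgr 1 1 y hy y hy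
  have cube := hSP 1 1 1 y hy y hy y hy
  have left := hSP 0 1 1 _ hs y hy y hy
  have right := hSP 1 1 0 y hy y hy _ hs
  simp only [spId, mul_one, mul_zero, add_zero, zero_add, h1, s0, s1] at cube left right
  have comm : mul (mul y y) y = mul y (mul y y) := by
    linear_combination (norm := module) (3 : K)⁻¹ • cube
  rw [comm] at left right
  linear_combination (norm := module) (3 : K)⁻¹ • right - (12 : K)⁻¹ • left
end

section
/- Let P carry a super-Poisson product xy. Then for every odd homogeneous element y ∈ P₁, one has y(y(yy)) = ((yy)y)y, i.e. yy³ = y³y where y³ = y(yy) = (yy)y; so the fourth power y⁴ of an odd element is well defined and equals y²y² = yy³ = y³y. -/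
/-- For a super-Poisson product and an odd homogeneous element `y`,
one has `y(y(yy)) = ((yy)y)y`, i.e. `yy³ = y³y` (with `y³ = y(yy) = (yy)y`);
hence the fourth power of an odd element is well defined and equals
`y²y² = yy³ = y³y`. -/
theorem superPoisson_odd_fourth_power_well_defined
    (K V : Type*) [Field K] [CharZero K] [AddCommGroup V] [Module K V]
    (P : ZMod 2 → Submodule K V) (hP : DirectSum.IsInternal P)
    (mul : V →ₗ[K] V →ₗ[K] V)
    (hgr : ∀ i j : ZMod 2, ∀ x ∈ P i, ∀ y ∈ P j, mul x y ∈ P (i + j))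
    (hSP : IsSuperPoisson K P (fun u v => mul u v))
    (y : V) (hy : y ∈ P 1) :
    mul y (mul y y) = mul (mul y y) y ∧
    mul y (mul y (mul y y)) = mul (mul (mul y y) y) y ∧
    mul (mul y y) (mul y y) = mul y (mul y (mul y y)) := by
  have hs : mul y y ∈ P 0 := hgr 1 1 y hy y hy
  have s0 : sgn K 0 = 1 := by simp [sgn]
  have s1 : sgn K 1 = -1 := by simp [sgn, ZMod.val_one]
  have h11 : (1 + 1 : ZMod 2) = 0 := by decide
  have h₁ := hSP 1 1 1 y hy y hy y hy
  have h₂ := hSP 0 1 1 _ hs y hy y hy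
  have h₃ := hSP 1 1 0 y hy y hy _ hs
  simp only [spId, mul_one, mul_zero, add_zero, zero_add, h11, s0, s1] at h₁ h₂ h₃
  have cube : mul y (mul y y) = mul (mul y y) y := by
    linear_combination (norm := module) (-1 / 3 : K) • h₁
  rw [cube] at h₂ h₃ ⊢
  have right_eq : mul (mul y y) (mul y y) = mul (mul (mul y y) y) y := by
    linear_combination (norm := module) (-1 / 4 : K) • h₂
  rw [right_eq] at h₃ ⊢
  have left_eq : mul y (mul (mul y y) y) = mul (mul (mul y y) y) y := by
    linear_combination (norm := module) (-1 / 3 : K) • h₃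
  exact ⟨rfl, left_eq, left_eq.symm⟩
end

section
/- Let P carry a super-Poisson product xy and let y ∈ P₁ be an odd homogeneous element. Define powers recursively by y¹ = y and y^{n+1} = y·yⁿ (product in P). Then for every n ≥ 2 and every p with 1 ≤ p ≤ n−1, one has y^p · y^{n−p} = yⁿ; that is, every odd homogeneous element generates an associative subalgebra (power associativity for odd elements). -/
/-- Powers of an element: `pw mul y 1 = y` and `pw mul y (n+1) = y · (pw mul y n)`.
(The value at `0` is irrelevant and set to `0`.) -/
def pw {V : Type*} [AddCommGroup V] (mul : V → V → V) (y : V) : ℕ → V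
  | 0 => 0
  | 1 => y
  | n + 2 => mul y (pw mul y (n + 1))

section PowerAssociativity

variable {K V : Type*} [Field K] [AddCommGroup V] [Module K V]

lemma sgn_zero : sgn K 0 = 1 := by simp [sgn]

lemma sgn_one : sgn K 1 = -1 := by simp [sgn, ZMod.val_one]

/-- The relation `spId` induces between the products `T p = y^p · y^(n-p)` of total degree
`n = i + j + k`, once all products of lower total degree are known to be powers. -/
def PowerRelation (K : Type*) {V : Type*} [Field K] [AddCommGroup V] [Module K V]
    (T : ℕ → V) (n : ℕ) : Prop :=
  ∀ i j k u v w : ℕ, 1 ≤ i → 1 ≤ j → 1 ≤ k → i + j + k = n →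
    i + j = u → i + k = v → j + k = w →
    ∀ a b c : ZMod 2, (i : ZMod 2) = a → (j : ZMod 2) = b → (k : ZMod 2) = c →
    (3 : K) • T u - (3 : K) • T i + sgn K (a * b) • T u - sgn K (b * c) • T v
      - sgn K (a * b + a * c) • T w + sgn K (a * c + b * c) • T v = 0

lemma natCast_zmod_two_of_even {m : ℕ} (h : m % 2 = 0) : (m : ZMod 2) = 0 :=
  (ZMod.natCast_eq_zero_iff_even).2 (Nat.even_iff.2 h)

lemma natCast_zmod_two_of_odd {m : ℕ} (h : m % 2 = 1) : (m : ZMod 2) = 1 :=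
  (ZMod.natCast_eq_one_iff_odd).2 (Nat.odd_iff.2 h)

lemma one_add_one_zmod_two : (1 + 1 : ZMod 2) = 0 := by decide

lemma pw_mem {P : ZMod 2 → Submodule K V} {mul : V → V → V}
    (hgr : ∀ i j : ZMod 2, ∀ x ∈ P i, ∀ y ∈ P j, mul x y ∈ P (i + j))
    {y : V} (hy : y ∈ P 1) : ∀ m : ℕ, pw mul y m ∈ P m
  | 0 => Submodule.zero_mem _
  | 1 => by simpa [pw] using hy
  | m + 2 => by
    have h := hgr _ _ y hy _ (pw_mem hgr hy (m + 1))
    have e : (1 : ZMod 2) + ((m + 1 : ℕ) : ZMod 2) = ((m + 2 : ℕ) : ZMod 2) := by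
      push_cast; ring
    rwa [e] at h

variable [CharZero K] {T : ℕ → V} {n : ℕ}

lemma PowerRelation.eq_of_even (H : PowerRelation K T n) (hn : n % 2 = 0)
    {p : ℕ} (hp : 1 ≤ p) (hpn : p < n) : T p = T 1 := by
  obtain rfl | hp1 := eq_or_ne p 1
  · rfl
  have E := H 1 (n - 2) 1 (n - 1) 2 (n - 1) (by omega) (by omega) (by omega) (by omega)
    (by omega) (by omega) (by omega) 1 0 1 (by simp)
    (natCast_zmod_two_of_even (by omega)) (by simp)
  have F := H 1 1 (n - 2) 2 (n - 1) (n - 1) (by omega) (by omega) (by omega) (by omega)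
    (by omega) (by omega) (by omega) 1 1 0 (by simp) (by simp)
    (natCast_zmod_two_of_even (by omega))
  simp only [mul_zero, mul_one, add_zero, zero_add, sgn_zero, sgn_one] at E F
  have last : T (n - 1) = T 1 := by
    linear_combination (norm := module) (1 / 6 : K) • E + (1 / 6 : K) • F
  have even : ∀ q, 1 ≤ q → q < n → q % 2 = 0 → T q = T 1 := by
    intro q hq hqn hq2
    have G := H 1 (q - 1) (n - q) q (n - q + 1) (n - 1) (by omega) (by omega) (by omega)
      (by omega) (by omega) (by omega) (by omega) 1 1 0 (by simp)
      (natCast_zmod_two_of_odd (by omega)) (natCast_zmod_two_of_even (by omega))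
    simp only [mul_zero, mul_one, add_zero, sgn_zero, sgn_one, last] at G
    linear_combination (norm := module) (1 / 2 : K) • G
  rcases Nat.mod_two_eq_zero_or_one p with h | h
  · exact even p hp hpn h
  have G := H 1 (p - 1) (n - p) p (n - p + 1) (n - 1) (by omega) (by omega) (by omega)
    (by omega) (by omega) (by omega) (by omega) 1 0 1 (by simp)
    (natCast_zmod_two_of_even (by omega)) (natCast_zmod_two_of_odd (by omega))
  simp only [mul_zero, mul_one, add_zero, zero_add, sgn_zero, sgn_one, last,
    even (n - p + 1) (by omega) (by omega) (by omega)] at G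
  linear_combination (norm := module) (1 / 4 : K) • G

lemma PowerRelation.eq_of_odd (H : PowerRelation K T n) (hn : n % 2 = 1)
    {p : ℕ} (hp : 1 ≤ p) (hpn : p < n) : T p = T 1 := by
  obtain rfl | hp1 := eq_or_ne p 1
  · rfl
  have odd' : ∀ q, 2 ≤ q → q < n → q % 2 = 1 →
      (4 : K) • T q = (3 : K) • T 1 + T (n - 1) := by
    intro q hq hqn hq2
    have G := H 1 (q - 1) (n - q) q (n - q + 1) (n - 1) (by omega) (by omega) (by omega)
      (by omega) (by omega) (by omega) (by omega) 1 0 0 (by simp)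
      (natCast_zmod_two_of_even (by omega)) (natCast_zmod_two_of_even (by omega))
    simp only [mul_zero, add_zero, sgn_zero] at G
    linear_combination (norm := module) G
  have E := H 1 (n - 2) 1 (n - 1) 2 (n - 1) (by omega) (by omega) (by omega) (by omega)
    (by omega) (by omega) (by omega) 1 1 1 (by simp)
    (natCast_zmod_two_of_odd (by omega)) (by simp)
  have F := H (n - 2) 1 1 (n - 1) (n - 1) 2 (by omega) (by omega) (by omega) (by omega)
    (by omega) (by omega) (by omega) 1 1 1 (natCast_zmod_two_of_odd (by omega))
    (by simp) (by simp)
  simp only [mul_one, one_add_one_zmod_two, sgn_zero, sgn_one] at E F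
  have last : T (n - 1) = T 1 := by
    obtain rfl | h3 := eq_or_ne n 3
    · norm_num at E ⊢
      linear_combination (norm := module) (1 / 3 : K) • E
    · have D := odd' (n - 2) (by omega) (by omega) (by omega)
      linear_combination (norm := module) (4 / 15 : K) • F + (1 / 5 : K) • D + (2 / 15 : K) • E
  have odd : ∀ q, 1 ≤ q → q < n → q % 2 = 1 → T q = T 1 := by
    intro q hq hqn hq2
    obtain rfl | hq1 := eq_or_ne q 1
    · rfl
    linear_combination (norm := module) (1 / 4 : K) • odd' q (by omega) hqn hq2 + (1 / 4 : K) • last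
  rcases Nat.mod_two_eq_zero_or_one p with h | h
  · obtain rfl | hlast := eq_or_ne p (n - 1)
    · exact last
    have G := H p 1 (n - p - 1) (p + 1) (n - 1) (n - p) (by omega) (by omega) (by omega)
      (by omega) (by omega) (by omega) (by omega) 0 1 0
      (natCast_zmod_two_of_even (by omega)) (by simp) (natCast_zmod_two_of_even (by omega))
    simp only [mul_zero, zero_mul, add_zero, sgn_zero,
      odd (p + 1) (by omega) (by omega) (by omega),
      odd (n - p) (by omega) (by omega) (by omega)] at G
    linear_combination (norm := module) (-1 / 3 : K) • G
  · exact odd p hp hpn h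

lemma PowerRelation.eq_one (H : PowerRelation K T n) {p : ℕ} (hp : 1 ≤ p) (hpn : p < n) :
    T p = T 1 :=
  (Nat.mod_two_eq_zero_or_one n).elim (fun h => H.eq_of_even h hp hpn)
    (fun h => H.eq_of_odd h hp hpn)

lemma IsSuperPoisson.mul_pw {P : ZMod 2 → Submodule K V} {mul : V → V → V}
    (hgr : ∀ i j : ZMod 2, ∀ x ∈ P i, ∀ y ∈ P j, mul x y ∈ P (i + j))
    (hSP : IsSuperPoisson K P mul) {y : V} (hy : y ∈ P 1) (n : ℕ) :
    ∀ p q : ℕ, 1 ≤ p → 1 ≤ q → p + q = n → mul (pw mul y p) (pw mul y q) = pw mul y n := by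
  induction n using Nat.strong_induction_on with
  | _ n ih =>
  intro p q hp hq hpq
  have H : PowerRelation K (fun r => mul (pw mul y r) (pw mul y (n - r))) n := by
    rintro i j k u v w hi hj hk hn rfl rfl rfl a b c rfl rfl rfl
    have h := hSP _ _ _ _ (pw_mem hgr hy i) _ (pw_mem hgr hy j) _ (pw_mem hgr hy k)
    have hij := ih (i + j) (by omega)
    have hik := ih (i + k) (by omega)
    have hjk := ih (j + k) (by omega)
    rw [spId, hij i j hi hj rfl, hij j i hj hi (add_comm j i), hjk j k hj hk rfl,
      hik i k hi hk rfl, hik k i hk hi (add_comm k i)] at h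
    simpa only [show n - (i + j) = k by omega, show n - (i + k) = j by omega,
      show n - (j + k) = i by omega, show n - i = j + k by omega] using h
  have h := H.eq_one hp (by omega)
  obtain ⟨m, rfl⟩ : ∃ m, n = m + 2 := ⟨n - 2, by omega⟩
  rw [show q = m + 2 - p by omega]
  exact h

end PowerAssociativity

/-- For a super-Poisson product and an odd homogeneous element `y`,
with powers defined by `y¹ = y`, `y^{n+1} = y·yⁿ`, one has `y^p · y^{n−p} = yⁿ`
for all `n ≥ 2` and `1 ≤ p ≤ n−1`: odd elements are power associative. -/
theorem superPoisson_odd_power_associative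
    (K V : Type*) [Field K] [CharZero K] [AddCommGroup V] [Module K V]
    (P : ZMod 2 → Submodule K V) (hP : DirectSum.IsInternal P)
    (mul : V →ₗ[K] V →ₗ[K] V)
    (hgr : ∀ i j : ZMod 2, ∀ x ∈ P i, ∀ y ∈ P j, mul x y ∈ P (i + j))
    (hSP : IsSuperPoisson K P (fun u v => mul u v))
    (y : V) (hy : y ∈ P 1) :
    ∀ n : ℕ, 2 ≤ n → ∀ p : ℕ, 1 ≤ p → p ≤ n - 1 →
      mul (pw (fun u v => mul u v) y p) (pw (fun u v => mul u v) y (n - p))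
        = pw (fun u v => mul u v) y n := by
  intro n hn p hp hpn
  exact hSP.mul_pw hgr hy n p (n - p) hp (by omega) (by omega)
end

section
/- Let P be a Z₂-graded K-vector space with any graded bilinear product xy (no further hypotheses). With v, v₁, v₂, v₃ defined as in the context, for all homogeneous x, y, z ∈ P the following identity holds: v(x,y,z) = (1/6)( 2v₁(x,y,z) + (−1)^{|x||z|} v₂(x,y,z) + v₃(x,y,z) + 2(−1)^{|x||z|+|y||z|} v₃(z,x,y) ). -/
/-- `v(x,y,z) = A(x,y,z) + (1/3)[(−1)^{|x||y|}(yx)z − (−1)^{|y||z|}(xz)y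
  − (−1)^{|x||y|+|x||z|}(yz)x + (−1)^{|x||z|+|y||z|}(zx)y]`. -/
def vmap (K : Type*) {V : Type*} [Field K] [AddCommGroup V] [Module K V]
    (mul : V → V → V) (i j k : ZMod 2) (x y z : V) : V :=
  assocr mul x y z
    + (3 : K)⁻¹ • (sgn K (i * j) • mul (mul y x) z - sgn K (j * k) • mul (mul x z) y
        - sgn K (i * j + i * k) • mul (mul y z) x + sgn K (i * k + j * k) • mul (mul z x) y)

/-- `v₁(x,y,z) = A(x,y,z) − (−1)^{|x||y|+|x||z|+|y||z|}A(z,y,x) + (−1)^{|x||y|}(yx)z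
  − (−1)^{|y||z|}x(zy) − (−1)^{|x||y|+|x||z|}(yz)x + (−1)^{|x||z|+|y||z|}z(xy)`. -/
def v1map (K : Type*) {V : Type*} [Field K] [AddCommGroup V] [Module K V]
    (mul : V → V → V) (i j k : ZMod 2) (x y z : V) : V :=
  assocr mul x y z - sgn K (i * j + i * k + j * k) • assocr mul z y x
    + sgn K (i * j) • mul (mul y x) z - sgn K (j * k) • mul x (mul z y)
    - sgn K (i * j + i * k) • mul (mul y z) x + sgn K (i * k + j * k) • mul z (mul x y)

/-- `v₂(x,y,z) = (−1)^{|x||z|}A(x,y,z) − (−1)^{|x||y|+|x||z|}A(y,x,z)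
  − (−1)^{|x||y|+|y||z|}A(z,y,x) − (−1)^{|x||z|+|y||z|}A(x,z,y)
  + (−1)^{|x||y|}A(y,z,x) + (−1)^{|y||z|}A(z,x,y)`. -/
def v2map (K : Type*) {V : Type*} [Field K] [AddCommGroup V] [Module K V]
    (mul : V → V → V) (i j k : ZMod 2) (x y z : V) : V :=
  sgn K (i * k) • assocr mul x y z - sgn K (i * j + i * k) • assocr mul y x z
    - sgn K (i * j + j * k) • assocr mul z y x - sgn K (i * k + j * k) • assocr mul x z y
    + sgn K (i * j) • assocr mul y z x + sgn K (j * k) • assocr mul z x y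

/-- `v₃(x,y,z) = A(x,y,z) − (−1)^{|x||y|}A(y,x,z) + (−1)^{|x||y|+|x||z|+|y||z|}A(z,y,x)
  + (−1)^{|y||z|}A(x,z,y) + (−1)^{|x||y|+|x||z|}A(y,z,x) − (−1)^{|x||z|+|y||z|}A(z,x,y)`. -/
def v3map (K : Type*) {V : Type*} [Field K] [AddCommGroup V] [Module K V]
    (mul : V → V → V) (i j k : ZMod 2) (x y z : V) : V :=
  assocr mul x y z - sgn K (i * j) • assocr mul y x z
    + sgn K (i * j + i * k + j * k) • assocr mul z y x + sgn K (j * k) • assocr mul x z y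
    + sgn K (i * j + i * k) • assocr mul y z x - sgn K (i * k + j * k) • assocr mul z x y

/-- For any graded bilinear product, on homogeneous elements
`v(x,y,z) = (1/6)(2v₁(x,y,z) + (−1)^{|x||z|}v₂(x,y,z) + v₃(x,y,z)
  + 2(−1)^{|x||z|+|y||z|}v₃(z,x,y))`. -/
theorem v_eq_combination_of_v1_v2_v3
    (K V : Type*) [Field K] [CharZero K] [AddCommGroup V] [Module K V]
    (P : ZMod 2 → Submodule K V) (hP : DirectSum.IsInternal P)
    (mul : V →ₗ[K] V →ₗ[K] V)
    (hgr : ∀ i j : ZMod 2, ∀ x ∈ P i, ∀ y ∈ P j, mul x y ∈ P (i + j)) :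
    ∀ i j k : ZMod 2, ∀ x ∈ P i, ∀ y ∈ P j, ∀ z ∈ P k,
      vmap K (fun u v => mul u v) i j k x y z
        = (6 : K)⁻¹ • ((2 : K) • v1map K (fun u v => mul u v) i j k x y z
            + sgn K (i * k) • v2map K (fun u v => mul u v) i j k x y z
            + v3map K (fun u v => mul u v) i j k x y z
            + (2 : K) • sgn K (i * k + j * k) • v3map K (fun u v => mul u v) k i j z x y) := by
  intro i j k x _ y _ z _
  simp only [vmap, v1map, v2map, v3map, assocr, mul_comm k i, mul_comm k j, sgn_add]
  rcases sgn_eq_one_or_neg_one K (i * j) with hij | hij <;>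
  rcases sgn_eq_one_or_neg_one K (i * k) with hik | hik <;>
  rcases sgn_eq_one_or_neg_one K (j * k) with hjk | hjk <;>
  · rw [hij, hik, hjk]
    module
end

section
/- Let P be a Z₂-graded K-vector space with any graded bilinear product xy (no further hypotheses). With v and v₂ defined as in the context, for all homogeneous x, y, z ∈ P: v₂(x,y,z) = (−1)^{|x||z|} v(x,y,z) − (−1)^{|x||y|+|x||z|} v(y,x,z) − (−1)^{|x||y|+|y||z|} v(z,y,x) − (−1)^{|x||z|+|y||z|} v(x,z,y) + (−1)^{|x||y|} v(y,z,x) + (−1)^{|y||z|} v(z,x,y). In particular, if v vanishes identically on homogeneous triples then so does v₂. -/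
theorem v2map_eq_combination_of_vmap (K : Type*) {V : Type*} [Field K] [AddCommGroup V]
    [Module K V] (mul : V → V → V) (i j k : ZMod 2) (x y z : V) :
    v2map K mul i j k x y z
      = sgn K (i * k) • vmap K mul i j k x y z
        - sgn K (i * j + i * k) • vmap K mul j i k y x z
        - sgn K (i * j + j * k) • vmap K mul k j i z y x
        - sgn K (i * k + j * k) • vmap K mul i k j x z y
        + sgn K (i * j) • vmap K mul j k i y z x
        + sgn K (j * k) • vmap K mul k i j z x y := by
  simp only [v2map, vmap, sgn_add, mul_comm j i, mul_comm k i, mul_comm k j]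
  rcases sgn_eq_one_or_neg_one K (i * j) with ha | ha <;>
  rcases sgn_eq_one_or_neg_one K (i * k) with hb | hb <;>
  rcases sgn_eq_one_or_neg_one K (j * k) with hc | hc <;>
  rw [ha, hb, hc] <;>
  module

/-- For any graded bilinear product, on homogeneous elements
`v₂(x,y,z) = (−1)^{|x||z|}v(x,y,z) − (−1)^{|x||y|+|x||z|}v(y,x,z)
  − (−1)^{|x||y|+|y||z|}v(z,y,x) − (−1)^{|x||z|+|y||z|}v(x,z,y)
  + (−1)^{|x||y|}v(y,z,x) + (−1)^{|y||z|}v(z,x,y)`; in particular if `v` vanishes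
identically on homogeneous triples then so does `v₂`. -/
theorem v2_eq_combination_of_v
    (K V : Type*) [Field K] [CharZero K] [AddCommGroup V] [Module K V]
    (P : ZMod 2 → Submodule K V) (hP : DirectSum.IsInternal P)
    (mul : V →ₗ[K] V →ₗ[K] V)
    (hgr : ∀ i j : ZMod 2, ∀ x ∈ P i, ∀ y ∈ P j, mul x y ∈ P (i + j)) :
    (∀ i j k : ZMod 2, ∀ x ∈ P i, ∀ y ∈ P j, ∀ z ∈ P k,
      v2map K (fun u v => mul u v) i j k x y z
        = sgn K (i * k) • vmap K (fun u v => mul u v) i j k x y z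
          - sgn K (i * j + i * k) • vmap K (fun u v => mul u v) j i k y x z
          - sgn K (i * j + j * k) • vmap K (fun u v => mul u v) k j i z y x
          - sgn K (i * k + j * k) • vmap K (fun u v => mul u v) i k j x z y
          + sgn K (i * j) • vmap K (fun u v => mul u v) j k i y z x
          + sgn K (j * k) • vmap K (fun u v => mul u v) k i j z x y) ∧
    ((∀ i j k : ZMod 2, ∀ x ∈ P i, ∀ y ∈ P j, ∀ z ∈ P k,
        vmap K (fun u v => mul u v) i j k x y z = 0) →
      ∀ i j k : ZMod 2, ∀ x ∈ P i, ∀ y ∈ P j, ∀ z ∈ P k,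
        v2map K (fun u v => mul u v) i j k x y z = 0) := by
  refine ⟨fun i j k x _ y _ z _ => v2map_eq_combination_of_vmap K _ i j k x y z,
    fun h i j k x hx y hy z hz => ?_⟩
  rw [v2map_eq_combination_of_vmap, h i j k x hx y hy z hz, h j i k y hy x hx z hz,
    h k j i z hz y hy x hx, h i k j x hx z hz y hy, h j k i y hy z hz x hx,
    h k i j z hz x hx y hy]
  simp
end

section
/- Let P be a Z₂-graded K-vector space with any graded bilinear product xy (no further hypotheses). With v and v₃ defined as in the context, for all homogeneous x, y, z ∈ P: v₃(x,y,z) = v(x,y,z) − (−1)^{|x||y|} v(y,x,z) + (−1)^{|x||y|+|x||z|+|y||z|} v(z,y,x) + (−1)^{|y||z|} v(x,z,y) + (−1)^{|x||y|+|x||z|} v(y,z,x) − (−1)^{|x||z|+|y||z|} v(z,x,y). In particular, if v vanishes identically on homogeneous triples then so does v₃. -/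
/-- The expansion of `v₃` in terms of `v` needs neither bilinearity of the product nor
homogeneity of the arguments. -/
theorem v3map_eq_combination_vmap (K : Type*) {V : Type*} [Field K] [AddCommGroup V]
    [Module K V] (mul : V → V → V) (i j k : ZMod 2) (x y z : V) :
    v3map K mul i j k x y z
      = vmap K mul i j k x y z
        - sgn K (i * j) • vmap K mul j i k y x z
        + sgn K (i * j + i * k + j * k) • vmap K mul k j i z y x
        + sgn K (j * k) • vmap K mul i k j x z y
        + sgn K (i * j + i * k) • vmap K mul j k i y z x
        - sgn K (i * k + j * k) • vmap K mul k i j z x y := by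
  simp only [v3map, vmap, sgn_add, mul_comm j i, mul_comm k i, mul_comm k j]
  rcases sgn_eq_one_or_neg_one K (i * j) with hij | hij <;>
  rcases sgn_eq_one_or_neg_one K (i * k) with hik | hik <;>
  rcases sgn_eq_one_or_neg_one K (j * k) with hjk | hjk <;>
  · rw [hij, hik, hjk]
    module

/-- For any graded bilinear product, on homogeneous elements
`v₃(x,y,z) = v(x,y,z) − (−1)^{|x||y|}v(y,x,z) + (−1)^{|x||y|+|x||z|+|y||z|}v(z,y,x)
  + (−1)^{|y||z|}v(x,z,y) + (−1)^{|x||y|+|x||z|}v(y,z,x)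
  − (−1)^{|x||z|+|y||z|}v(z,x,y)`; in particular if `v` vanishes identically on
homogeneous triples then so does `v₃`. -/
theorem v3_eq_combination_of_v
    (K V : Type*) [Field K] [CharZero K] [AddCommGroup V] [Module K V]
    (P : ZMod 2 → Submodule K V) (hP : DirectSum.IsInternal P)
    (mul : V →ₗ[K] V →ₗ[K] V)
    (hgr : ∀ i j : ZMod 2, ∀ x ∈ P i, ∀ y ∈ P j, mul x y ∈ P (i + j)) :
    (∀ i j k : ZMod 2, ∀ x ∈ P i, ∀ y ∈ P j, ∀ z ∈ P k,
      v3map K (fun u v => mul u v) i j k x y z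
        = vmap K (fun u v => mul u v) i j k x y z
          - sgn K (i * j) • vmap K (fun u v => mul u v) j i k y x z
          + sgn K (i * j + i * k + j * k) • vmap K (fun u v => mul u v) k j i z y x
          + sgn K (j * k) • vmap K (fun u v => mul u v) i k j x z y
          + sgn K (i * j + i * k) • vmap K (fun u v => mul u v) j k i y z x
          - sgn K (i * k + j * k) • vmap K (fun u v => mul u v) k i j z x y) ∧
    ((∀ i j k : ZMod 2, ∀ x ∈ P i, ∀ y ∈ P j, ∀ z ∈ P k,
        vmap K (fun u v => mul u v) i j k x y z = 0) →
      ∀ i j k : ZMod 2, ∀ x ∈ P i, ∀ y ∈ P j, ∀ z ∈ P k,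
        v3map K (fun u v => mul u v) i j k x y z = 0) := by
  refine ⟨fun i j k x _ y _ z _ => v3map_eq_combination_vmap K _ i j k x y z,
    fun hv i j k x hx y hy z hz => ?_⟩
  rw [v3map_eq_combination_vmap, hv i j k x hx y hy z hz, hv j i k y hy x hx z hz,
    hv k j i z hz y hy x hx, hv i k j x hx z hz y hy, hv j k i y hy z hz x hx,
    hv k i j z hz x hx y hy]
  simp only [smul_zero, sub_zero, add_zero]
end
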